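/- For every p > p⃗_c, the H-model with parameter p percolates: θ_H(p) > 0. -/

import Mathlib

open MeasureTheory ENNReal

namespace RandomOrientation

/-- One step of the base-`(p, 1-p)` expansion map on `[0,1)`. -/
noncomputable def expand (p x : ℝ) : ℝ := if x < p then x / p else (x - p) / (1 - p)

/-- The `n`-th digit of the Bernoulli(`p`) expansion of `x`: for `x` uniformly
distributed on `[0,1)` the digits are i.i.d. `{true, false}`-valued with
`P(true) = p`. -/
noncomputable def bernDigit (p : ℝ) (n : ℕ) (x : ℝ) : Bool :=
  decide ((expand p)^[n] x < p)

/-- The product over the countable index set `I` of Bernoulli(`p`) measures on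
`Bool` (`P(true) = p`), realized as the joint distribution of the digits of the
Bernoulli(`p`) expansion of a uniform random point of `[0,1)`. -/
noncomputable def bernoulliProduct (I : Type*) [Encodable I] (p : ℝ) :
    Measure (I → Bool) :=
  Measure.map (fun x i => bernDigit p (Encodable.encode i) x)
    (volume.restrict (Set.Ico (0 : ℝ) 1))

/-- Edges of `ℤ²`: `(v, false)` is the horizontal edge from `v` to `v + (1,0)`,
`(v, true)` the vertical edge from `v` to `v + (0,1)`. -/
abbrev Edge : Type := (ℤ × ℤ) × Bool

/-- An orientation configuration of the edges of `ℤ²`. -/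
abbrev Config : Type := Edge → Bool

def eSrc (e : Edge) : ℤ × ℤ := e.1

def eDst (e : Edge) : ℤ × ℤ := if e.2 then (e.1.1, e.1.2 + 1) else (e.1.1 + 1, e.1.2)

/-- The law of the random orientation with parameter `p`: each edge independently
carries the bit `true` with probability `p`. -/
noncomputable def mu (p : ℝ) : Measure Config := bernoulliProduct Edge p

/-- The directed-edge relation of Grimmett's random-orientation model:
`ω e = true` means the edge `e` is oriented in the positive coordinate direction
(rightwards resp. upwards), `ω e = false` in the negative one. -/
def gStep (ω : Config) (u v : ℤ × ℤ) : Prop :=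
  ∃ e : Edge, (eSrc e = u ∧ eDst e = v ∧ ω e = true) ∨ (eSrc e = v ∧ eDst e = u ∧ ω e = false)

/-- Squared euclidean norm on `ℤ²`. -/
def normSq (v : ℤ × ℤ) : ℤ := v.1 ^ 2 + v.2 ^ 2

/-- The directed-edge relation of the H-model: `ω e = true` means the edge `e` is
oriented away from the origin, i.e. towards its endpoint of larger euclidean norm
(adjacent vertices of `ℤ²` never have equal norms). -/
def hStep (ω : Config) (u v : ℤ × ℤ) : Prop :=
  ∃ e : Edge, ((eSrc e = u ∧ eDst e = v) ∨ (eSrc e = v ∧ eDst e = u)) ∧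
    ω e = decide (normSq u < normSq v)

/-- There is an infinite directed self-avoiding path starting at the origin,
all of whose vertices lie in `S`, for the directed-step relation `R`. -/
def percolates (R : ℤ × ℤ → ℤ × ℤ → Prop) (S : Set (ℤ × ℤ)) : Prop :=
  ∃ γ : ℕ → ℤ × ℤ, γ 0 = (0, 0) ∧ Function.Injective γ ∧
    (∀ n, R (γ n) (γ (n + 1))) ∧ ∀ n, γ n ∈ S

/-- The (closed) North-East quadrant of `ℤ²`. -/
def NEquad : Set (ℤ × ℤ) := {v | 0 ≤ v.1 ∧ 0 ≤ v.2}

/-- `θ_H(p)`: percolation probability of the H-model with parameter `p`. -/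
noncomputable def thetaH (p : ℝ) : ℝ≥0∞ := mu p {ω | percolates (hStep ω) Set.univ}

/-- `θ_NE(p)`: probability of an infinite directed self-avoiding path from the
origin staying in the North-East quadrant, in the random-orientation model. -/
noncomputable def thetaNE (p : ℝ) : ℝ≥0∞ := mu p {ω | percolates (gStep ω) NEquad}

/-- `θ_G(p)`: percolation probability of Grimmett's random-orientation model. -/
noncomputable def thetaG (p : ℝ) : ℝ≥0∞ := mu p {ω | percolates (gStep ω) Set.univ}

/-- One step of oriented (north-east) bond percolation: from `u` one may move
rightwards or upwards along an open (`true`) edge. -/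
def neStep (ω : Config) (u v : ℤ × ℤ) : Prop :=
  (v = (u.1 + 1, u.2) ∧ ω ((u, false) : Edge) = true) ∨
  (v = (u.1, u.2 + 1) ∧ ω ((u, true) : Edge) = true)

/-- Probability of an infinite open oriented (self-avoiding) path from the origin
in oriented bond percolation with parameter `p`. -/
noncomputable def thetaVec (p : ℝ) : ℝ≥0∞ := mu p {ω | percolates (neStep ω) Set.univ}

/-- The critical probability `p⃗_c` of oriented bond percolation on `ℤ²`. -/
noncomputable def vecPc : ℝ := sInf {p : ℝ | 0 < thetaVec p}

/-- The uniform distribution on `[0,1)`. -/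
noncomputable abbrev unif : Measure ℝ := volume.restrict (Set.Ico (0 : ℝ) 1)

instance isProbabilityMeasure_unif : IsProbabilityMeasure unif := ⟨by simp⟩

lemma measurable_decide_lt (p : ℝ) : Measurable fun x : ℝ => decide (x < p) :=
  measurable_to_bool <| by
    have : (fun x : ℝ => decide (x < p)) ⁻¹' {true} = Set.Iio p := by ext; simp
    rw [this]
    exact measurableSet_Iio

lemma measurable_expand (p : ℝ) : Measurable (expand p) :=
  Measurable.ite measurableSet_Iio (by fun_prop) (by fun_prop)

lemma measurable_bernDigit (p : ℝ) (n : ℕ) : Measurable (bernDigit p n) :=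
  (measurable_decide_lt p).comp ((measurable_expand p).iterate n)

lemma unif_Iio_inter_preimage_expand {p : ℝ} (hp0 : 0 < p) (hp1 : p ≤ 1) {B : Set ℝ}
    (hB : MeasurableSet B) :
    unif (Set.Iio p ∩ expand p ⁻¹' B) = ENNReal.ofReal p * unif B := by
  rw [Measure.restrict_apply (measurableSet_Iio.inter (measurable_expand p hB)),
    Measure.restrict_apply hB]
  have : Set.Iio p ∩ expand p ⁻¹' B ∩ Set.Ico 0 1 = (· * p⁻¹) ⁻¹' (B ∩ Set.Ico 0 1) := by
    ext x
    simp only [Set.mem_inter_iff, Set.mem_Iio, Set.mem_preimage, Set.mem_Ico, expand,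
      ← div_eq_mul_inv, div_lt_one hp0]
    constructor
    · rintro ⟨⟨h1, h2⟩, h3, h4⟩
      rw [if_pos h1] at h2
      exact ⟨h2, by positivity, h1⟩
    · rintro ⟨h2, h3, h1⟩
      rw [if_pos h1]
      refine ⟨⟨h1, h2⟩, ?_, by linarith⟩
      simpa [div_mul_cancel₀ x hp0.ne'] using mul_nonneg h3 hp0.le
  rw [this, Real.volume_preimage_mul_right (inv_ne_zero hp0.ne'), inv_inv, abs_of_pos hp0]

lemma unif_Ici_inter_preimage_expand {p : ℝ} (hp0 : 0 < p) (hp1 : p ≤ 1) {B : Set ℝ}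
    (hB : MeasurableSet B) :
    unif (Set.Ici p ∩ expand p ⁻¹' B) = ENNReal.ofReal (1 - p) * unif B := by
  rw [Measure.restrict_apply (measurableSet_Ici.inter (measurable_expand p hB)),
    Measure.restrict_apply hB]
  rcases hp1.eq_or_lt with rfl | hp1
  · have : Set.Ici 1 ∩ expand 1 ⁻¹' B ∩ Set.Ico 0 1 = ∅ := by
      ext x
      simp only [Set.mem_inter_iff, Set.mem_Ici, Set.mem_Ico, Set.mem_empty_iff_false, iff_false]
      rintro ⟨⟨h1, -⟩, -, h2⟩
      linarith
    simp [this]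
  have hq : 0 < 1 - p := by linarith
  have : Set.Ici p ∩ expand p ⁻¹' B ∩ Set.Ico 0 1 =
      (· + -p) ⁻¹' ((· * (1 - p)⁻¹) ⁻¹' (B ∩ Set.Ico 0 1)) := by
    ext x
    simp only [Set.mem_inter_iff, Set.mem_Ici, Set.mem_preimage, Set.mem_Ico, expand,
      ← div_eq_mul_inv, div_lt_one hq, ← sub_eq_add_neg]
    constructor
    · rintro ⟨⟨h1, h2⟩, h3, h4⟩
      rw [if_neg h1.not_gt] at h2
      exact ⟨h2, div_nonneg (by linarith) hq.le, by linarith⟩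
    · rintro ⟨h2, h3, h4⟩
      have h1 : p ≤ x := by
        have := mul_nonneg h3 hq.le
        rw [div_mul_cancel₀ _ hq.ne'] at this
        linarith
      rw [if_neg h1.not_gt]
      exact ⟨⟨h1, h2⟩, by linarith, by linarith⟩
  rw [this, measure_preimage_add_right, Real.volume_preimage_mul_right (inv_ne_zero hq.ne'),
    inv_inv, abs_of_pos hq]

lemma measurePreserving_expand {p : ℝ} (hp0 : 0 < p) (hp1 : p ≤ 1) :
    MeasurePreserving (expand p) unif unif := by
  refine ⟨measurable_expand p, Measure.ext fun B hB => ?_⟩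
  rw [Measure.map_apply (measurable_expand p) hB,
    ← measure_inter_add_sdiff (expand p ⁻¹' B) (measurableSet_Iio (a := p)), Set.inter_comm,
    Set.sdiff_eq, Set.compl_Iio, Set.inter_comm _ (Set.Ici p),
    unif_Iio_inter_preimage_expand hp0 hp1 hB, unif_Ici_inter_preimage_expand hp0 hp1 hB,
    ← add_mul, ← ENNReal.ofReal_add hp0.le (by linarith)]
  simp

/-- The first digit is independent of the remaining expansion. -/
lemma unif_digit_inter_preimage_expand {p : ℝ} (hp0 : 0 < p) (hp1 : p ≤ 1) (t : Set Bool)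
    {B : Set ℝ} (hB : MeasurableSet B) :
    unif ((fun x => decide (x < p)) ⁻¹' t ∩ expand p ⁻¹' B) =
      unif ((fun x => decide (x < p)) ⁻¹' t) * unif B := by
  have hlt := unif_Iio_inter_preimage_expand hp0 hp1 MeasurableSet.univ
  have hge := unif_Ici_inter_preimage_expand hp0 hp1 MeasurableSet.univ
  simp only [Set.preimage_univ, Set.inter_univ, measure_univ, mul_one] at hlt hge
  by_cases h1 : true ∈ t <;> by_cases h2 : false ∈ t
  · have : (fun x => decide (x < p)) ⁻¹' t = Set.univ := by
      ext x; by_cases h : x < p <;> simp [h, h1, h2]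
    rw [this, Set.univ_inter, measure_univ, one_mul,
      (measurePreserving_expand hp0 hp1).measure_preimage hB.nullMeasurableSet]
  · have : (fun x => decide (x < p)) ⁻¹' t = Set.Iio p := by
      ext x; by_cases h : x < p <;> simp [h, h1, h2]
    rw [this, unif_Iio_inter_preimage_expand hp0 hp1 hB, hlt]
  · have : (fun x => decide (x < p)) ⁻¹' t = Set.Ici p := by
      ext x; by_cases h : x < p <;> simp [h, h1, h2, not_lt.1]
    rw [this, unif_Ici_inter_preimage_expand hp0 hp1 hB, hge]
  · have : (fun x => decide (x < p)) ⁻¹' t = ∅ := by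
      ext x; by_cases h : x < p <;> simp [h, h1, h2]
    simp [this]

lemma unif_forall_bernDigit_mem {p : ℝ} (hp0 : 0 < p) (hp1 : p ≤ 1) (N : ℕ)
    (t : ℕ → Set Bool) :
    unif {x | ∀ i < N, bernDigit p i x ∈ t i} =
      ∏ i ∈ Finset.range N, unif ((fun x => decide (x < p)) ⁻¹' t i) := by
  induction N generalizing t with
  | zero => simp
  | succ N ih =>
    have hm : MeasurableSet {x | ∀ i < N, bernDigit p i x ∈ t (i + 1)} := by
      simp only [Set.ofPred_forall]
      exact .iInter fun i => .iInter fun _ => measurable_bernDigit p i (.of_discrete)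
    have : {x | ∀ i < N + 1, bernDigit p i x ∈ t i} =
        (fun x => decide (x < p)) ⁻¹' t 0 ∩
          expand p ⁻¹' {x | ∀ i < N, bernDigit p i x ∈ t (i + 1)} := by
      ext x
      simp only [Nat.forall_lt_succ_left]
      rfl
    rw [this, unif_digit_inter_preimage_expand hp0 hp1 _ hm, ih, Finset.prod_range_succ', mul_comm]

lemma map_bernDigit {p : ℝ} (hp0 : 0 < p) (hp1 : p ≤ 1) (n : ℕ) :
    unif.map (bernDigit p n) = unif.map fun x => decide (x < p) := by
  have h := (measurePreserving_expand hp0 hp1).iterate n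
  conv_rhs => rw [← h.map_eq]
  rw [Measure.map_map (measurable_decide_lt p) h.measurable]
  rfl

lemma iIndepFun_bernDigit {p : ℝ} (hp0 : 0 < p) (hp1 : p ≤ 1) :
    ProbabilityTheory.iIndepFun (bernDigit p) unif := by
  have hprob : IsProbabilityMeasure (unif.map fun x => decide (x < p)) :=
    Measure.isProbabilityMeasure_map (measurable_decide_lt p).aemeasurable
  rw [ProbabilityTheory.iIndepFun_iff_map_fun_eq_infinitePi_map (measurable_bernDigit p)]
  simp only [map_bernDigit hp0 hp1]
  refine Measure.eq_infinitePi _ fun s t ht => ?_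
  classical
  obtain ⟨N, hN⟩ := s.exists_nat_subset_range
  have hpre : (fun x i => bernDigit p i x) ⁻¹' (Set.pi s t) =
      {x | ∀ i < N, bernDigit p i x ∈ if i ∈ s then t i else Set.univ} := by
    ext x
    simp only [Set.mem_preimage, Set.mem_pi, Finset.mem_coe, Set.mem_ofPred_eq]
    refine ⟨fun h i _ => ?_, fun h i hi => ?_⟩
    · split_ifs with hi
      exacts [h i hi, trivial]
    · simpa [hi] using h i (Finset.mem_range.1 (hN hi))
  rw [Measure.map_apply (measurable_pi_lambda _ (measurable_bernDigit p))
    (.pi s.countable_toSet fun i _ => ht i), hpre, unif_forall_bernDigit_mem hp0 hp1,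
    ← Finset.prod_subset hN]
  · refine Finset.prod_congr rfl fun i hi => ?_
    rw [if_pos hi, Measure.map_apply (measurable_decide_lt p) (ht i)]
  · intro i _ hi
    rw [if_neg hi, Set.preimage_univ, measure_univ]

/-- Grand coupling: `mu p` is the law of the edges whose independent uniform labels are
below `p`. -/
lemma mu_eq_map_infinitePi {p : ℝ} (hp0 : 0 < p) (hp1 : p ≤ 1) :
    mu p = (Measure.infinitePi fun _ : Edge => unif).map fun x e => decide (x e < p) := by
  rw [Measure.infinitePi_map_pi _ fun _ => measurable_decide_lt p]
  have h := (iIndepFun_bernDigit hp0 hp1).precomp (Encodable.encode_injective (α := Edge))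
  have h' := h.map_fun_eq_infinitePi_map fun e => measurable_bernDigit p (Encodable.encode e)
  simp only [map_bernDigit hp0 hp1] at h'
  exact h'

lemma mu_mono {p q : ℝ} (hq0 : 0 < q) (hqp : q ≤ p) (hp1 : p ≤ 1) {S : Set Config}
    (hS : MeasurableSet S) (hup : ∀ ω ∈ S, ∀ ω', (∀ e, ω e = true → ω' e = true) → ω' ∈ S) :
    mu q S ≤ mu p S := by
  have hm (r : ℝ) : Measurable fun (x : Edge → ℝ) e => decide (x e < r) :=
    measurable_pi_lambda _ fun e => (measurable_decide_lt r).comp (measurable_pi_apply e)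
  rw [mu_eq_map_infinitePi hq0 (hqp.trans hp1), mu_eq_map_infinitePi (hq0.trans_le hqp) hp1,
    Measure.map_apply (hm q) hS, Measure.map_apply (hm p) hS]
  refine measure_mono fun x hx => hup _ hx _ fun e he => ?_
  simp only [decide_eq_true_eq] at he ⊢
  exact he.trans_le hqp

/-- The endpoint of the north-east path that starts at the origin and follows the first `n`
directions of `d` (`true` for up, `false` for right). -/
def nePath (d : ℕ → Bool) : ℕ → ℤ × ℤ
  | 0 => (0, 0)
  | n + 1 => eDst (nePath d n, d n)

lemma neStep_iff (ω : Config) (u v : ℤ × ℤ) :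
    neStep ω u v ↔ ∃ b : Bool, v = eDst (u, b) ∧ ω (u, b) = true := by
  simp [neStep, eDst]

lemma injective_of_neStep {ω : Config} {γ : ℕ → ℤ × ℤ} (h : ∀ n, neStep ω (γ n) (γ (n + 1))) :
    Function.Injective γ := by
  have hsum : StrictMono fun n => (γ n).1 + (γ n).2 := by
    refine strictMono_nat_of_lt_succ fun n => ?_
    rcases h n with ⟨h, -⟩ | ⟨h, -⟩ <;> simp only [h] <;> omega
  exact fun m n hmn => hsum.injective (by simp [hmn])

lemma percolates_neStep_iff (ω : Config) :
    percolates (neStep ω) Set.univ ↔ ∃ d : ℕ → Bool, ∀ n, ω (nePath d n, d n) = true := by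
  constructor
  · rintro ⟨γ, h0, -, hstep, -⟩
    simp only [neStep_iff] at hstep
    choose d hd hω using hstep
    have hγ : ∀ n, γ n = nePath d n := fun n => by
      induction n with
      | zero => exact h0
      | succ n ih => rw [hd, ih]; rfl
    exact ⟨d, fun n => hγ n ▸ hω n⟩
  · rintro ⟨d, hd⟩
    have hstep : ∀ n, neStep ω (nePath d n) (nePath d (n + 1)) := fun n =>
      (neStep_iff _ _ _).2 ⟨d n, rfl, hd n⟩
    exact ⟨nePath d, rfl, injective_of_neStep hstep, hstep, fun _ => trivial⟩

lemma continuous_nePath (n : ℕ) : Continuous fun d => nePath d n := by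
  induction n with
  | zero => exact continuous_const
  | succ n ih =>
    exact (continuous_of_discreteTopology (f := eDst)).comp (ih.prodMk (continuous_apply n))

lemma measurableSet_percolates_neStep :
    MeasurableSet {ω : Config | percolates (neStep ω) Set.univ} := by
  have heval : Continuous fun a : Config × Edge => a.1 a.2 :=
    continuous_prod_of_discrete_right.2 continuous_apply
  have hclosed : IsClosed {a : Config × (ℕ → Bool) | ∀ n, a.1 (nePath a.2 n, a.2 n) = true} := by
    simp only [Set.ofPred_forall]
    refine isClosed_iInter fun n => isClosed_eq ?_ continuous_const
    exact heval.comp (continuous_fst.prodMk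
      (((continuous_nePath n).comp continuous_snd).prodMk
        ((continuous_apply n).comp continuous_snd)))
  have himage : {ω : Config | percolates (neStep ω) Set.univ} =
      Prod.fst '' {a : Config × (ℕ → Bool) | ∀ n, a.1 (nePath a.2 n, a.2 n) = true} := by
    ext ω
    simp [percolates_neStep_iff]
  rw [himage]
  exact (hclosed.isCompact.image continuous_fst).measurableSet

lemma percolates_neStep_mono {ω ω' : Config} (h : ∀ e, ω e = true → ω' e = true)
    (hω : percolates (neStep ω) Set.univ) : percolates (neStep ω') Set.univ := by
  rw [percolates_neStep_iff] at hω ⊢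
  exact hω.imp fun d hd n => h _ (hd n)

lemma bernDigit_eq_false_of_nonpos {p : ℝ} (hp : p ≤ 0) (n : ℕ) {x : ℝ}
    (hx : x ∈ Set.Ico (0 : ℝ) 1) : bernDigit p n x = false := by
  have hmaps : Set.MapsTo (expand p) (Set.Ico 0 1) (Set.Ico 0 1) := by
    rintro y ⟨h0, h1⟩
    rw [expand, if_neg (by linarith)]
    exact ⟨div_nonneg (by linarith) (by linarith), (div_lt_one (by linarith)).2 (by linarith)⟩
  have := (hmaps.iterate n hx).1
  simp only [bernDigit, decide_eq_false_iff_not, not_lt]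
  linarith

lemma pos_of_thetaVec_pos {p : ℝ} (h : 0 < thetaVec p) : 0 < p := by
  by_contra! hp
  refine h.ne' ?_
  rw [thetaVec, mu, bernoulliProduct, Measure.map_apply (measurable_pi_lambda _ fun e =>
    measurable_bernDigit p (Encodable.encode e)) measurableSet_percolates_neStep,
    Measure.restrict_apply' measurableSet_Ico]
  convert measure_empty (μ := (volume : Measure ℝ))
  rw [Set.eq_empty_iff_forall_notMem]
  rintro x ⟨hx, hx01⟩
  obtain ⟨d, hd⟩ := (percolates_neStep_iff _).1 hx
  simpa [bernDigit_eq_false_of_nonpos hp _ hx01] using hd 0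

lemma bernDigit_one (n : ℕ) {x : ℝ} (hx : x < 1) : bernDigit 1 n x = true := by
  have hfix : Function.IsFixedPt (expand 1) x := by simp [Function.IsFixedPt, expand, hx]
  simp [bernDigit, hfix.iterate n |>.eq, hx]

lemma thetaVec_one_pos : 0 < thetaVec 1 := by
  rw [thetaVec, mu, bernoulliProduct, Measure.map_apply (measurable_pi_lambda _ fun e =>
    measurable_bernDigit 1 (Encodable.encode e)) measurableSet_percolates_neStep,
    Measure.restrict_apply' measurableSet_Ico, Set.inter_eq_right.2]
  · simp
  · exact fun x hx => (percolates_neStep_iff _).2 ⟨fun _ => true, fun n => bernDigit_one _ hx.2⟩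

lemma nePath_nonneg (d : ℕ → Bool) (n : ℕ) : 0 ≤ (nePath d n).1 ∧ 0 ≤ (nePath d n).2 := by
  induction n with
  | zero => simp [nePath]
  | succ n ih => cases h : d n <;> simp [nePath, eDst, h] <;> omega

/-- Steps to the north or east from the north-east quadrant point away from the origin. -/
lemma normSq_lt_normSq_eDst {u : ℤ × ℤ} (h1 : 0 ≤ u.1) (h2 : 0 ≤ u.2) (b : Bool) :
    normSq u < normSq (eDst (u, b)) := by
  cases b <;> simp [normSq, eDst] <;> nlinarith

lemma percolates_hStep_of_neStep {ω : Config} (h : percolates (neStep ω) Set.univ) :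
    percolates (hStep ω) Set.univ := by
  obtain ⟨d, hd⟩ := (percolates_neStep_iff ω).1 h
  have hstep : ∀ n, neStep ω (nePath d n) (nePath d (n + 1)) := fun n =>
    (neStep_iff _ _ _).2 ⟨d n, rfl, hd n⟩
  refine ⟨nePath d, rfl, injective_of_neStep hstep, fun n => ?_, fun _ => trivial⟩
  have hlt := normSq_lt_normSq_eDst (nePath_nonneg d n).1 (nePath_nonneg d n).2 (d n)
  exact ⟨(nePath d n, d n), .inl ⟨rfl, rfl⟩, by rw [hd n]; exact (decide_eq_true hlt).symm⟩

/-- For every `p > p⃗_c`, the H-model with parameter `p` percolates. -/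
theorem thetaH_pos_of_vecPc_lt (p : ℝ) (hp : vecPc < p) (hp1 : p ≤ 1) :
    0 < thetaH p := by
  obtain ⟨q, hq, hqp⟩ := exists_lt_of_csInf_lt ⟨1, thetaVec_one_pos⟩ hp
  calc 0 < thetaVec q := hq
    _ ≤ thetaVec p := mu_mono (pos_of_thetaVec_pos hq) hqp.le hp1 measurableSet_percolates_neStep
        fun _ hω _ h => percolates_neStep_mono h hω
    _ ≤ thetaH p := measure_mono fun _ => percolates_hStep_of_neStep

end RandomOrientation
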